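/- Let Θ = (α, ρ_r, ρ_d, ρ_s, ρ_0, T) be a parameter tuple with δ := ρ_s/ρ_r satisfying min(T/4, 1/(3·ρ_0/ρ_r), 3·(ρ_d/ρ_r)/(2·ρ_0/ρ_r)) > 10 and ρ_r > α/(2δ), and let R > 0 be such that K'_csi(R,Θ) < (3/4)·K_max(Θ), where K'_csi(R,Θ) := max(min(R/x'(R,Θ), K_max(Θ)), 1). For a fixed real K define ζ'_zf(K,R,Θ) := R / inf{ P(M,K,τ,R,Θ) : (M,τ) ∈ ℝ², M > K, K ≤ τ < T }. Then for every real K with (4/3)·K'_csi(R,Θ) < K < K_max(Θ), one has 1 ≤ ζ'_zf(R,Θ)/ζ'_zf(K,R,Θ) < 2K/K'_csi(R,Θ). -/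

import Mathlib

open Real

/-- Uplink SINR-like quantity γ_u(M,K,τ,R,T). -/
noncomputable def gammaU (M K τ R T : ℝ) : ℝ :=
  ((K + τ) * ((2:ℝ) ^ (R / (K * (1 - τ / T))) - 1)) / (2 * τ * (M - K)) +
    Real.sqrt ((((K + τ) * ((2:ℝ) ^ (R / (K * (1 - τ / T))) - 1)) / (2 * τ * (M - K))) ^ 2 +
      ((2:ℝ) ^ (R / (K * (1 - τ / T))) - 1) / (τ * (M - K)))

/-- Total normalized power consumption P(M,K,τ,R,Θ). -/
noncomputable def Ptot (M K τ R α ρr ρd ρs ρ0 T : ℝ) : ℝ :=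
  α * K * gammaU M K τ R T + ρs + K * (ρd + (8/3) * K ^ 2 * ρ0 / T) +
    M * (ρr + 2 * K * ρ0 + 4 * K ^ 2 * ρ0 / T)

/-- Optimal normalized energy efficiency ζ*_zf(R,Θ) (integer optimization). -/
noncomputable def zetaZfStar (R α ρr ρd ρs ρ0 T : ℝ) : ℝ :=
  R / sInf {p : ℝ | ∃ M K τ : ℤ, 1 ≤ K ∧ K ≤ τ ∧ (τ : ℝ) < T ∧ K < M ∧
    p = Ptot (M : ℝ) (K : ℝ) (τ : ℝ) R α ρr ρd ρs ρ0 T}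

/-- Maximum number of users K_max(Θ). -/
noncomputable def Kmax (ρr ρd ρ0 T : ℝ) : ℝ :=
  min (T / 4) (min (ρr / (3 * ρ0)) (3 * ρd / (2 * ρ0)))

/-- The function g(x). -/
noncomputable def gfun (x : ℝ) : ℝ :=
  Real.sqrt (x / ((2:ℝ) ^ x - 1)) * ((2:ℝ) ^ x * x * Real.log 2 - (2:ℝ) ^ x + 1)

/-- Ideal (perfect CSI) power consumption P_csi(M,K,R,Θ). -/
noncomputable def Pcsi (M K R α ρr ρd ρs : ℝ) : ℝ :=
  α * K * ((2:ℝ) ^ (R / K) - 1) / (M - K) + M * ρr + K * ρd + ρs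

/-- Relaxed (real-valued) optimal EE ζ'_zf(R,Θ) with K ≤ K_max(Θ). -/
noncomputable def zetaZfPrime (R α ρr ρd ρs ρ0 T : ℝ) : ℝ :=
  R / sInf {p : ℝ | ∃ M K τ : ℝ, 1 ≤ K ∧ K ≤ Kmax ρr ρd ρ0 T ∧ K ≤ τ ∧ τ < T ∧ K < M ∧
    p = Ptot M K τ R α ρr ρd ρs ρ0 T}

/-- Optimal EE of the ideal perfect-CSI system ζ'_csi(R,Θ). -/
noncomputable def zetaCsiPrime (R α ρr ρd ρs ρ0 T : ℝ) : ℝ :=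
  R / sInf {p : ℝ | ∃ M K : ℝ, 1 ≤ K ∧ K ≤ Kmax ρr ρd ρ0 T ∧ K < M ∧
    p = Pcsi M K R α ρr ρd ρs}

/-- Relaxed optimal EE with the number of users fixed to K. -/
noncomputable def zetaZfFixedK (K R α ρr ρd ρs ρ0 T : ℝ) : ℝ :=
  R / sInf {p : ℝ | ∃ M τ : ℝ, K < M ∧ K ≤ τ ∧ τ < T ∧
    p = Ptot M K τ R α ρr ρd ρs ρ0 T}

/-- `y ↦ y e^y - e^y + 1` is nonnegative. -/
lemma mul_exp_sub_exp_add_one_nonneg (y : ℝ) : 0 ≤ exp y * y - exp y + 1 := by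
  have h1 := Real.add_one_le_exp (-y)
  have h2 : exp y * exp (-y) = 1 := by rw [← Real.exp_add]; simp
  nlinarith [mul_le_mul_of_nonneg_left h1 (Real.exp_pos y).le]

/-- `y ↦ y e^y - e^y + 1` is monotone on the nonnegative reals. -/
lemma mul_exp_sub_exp_add_one_le {y z : ℝ} (hy : 0 ≤ y) (hyz : y ≤ z) :
    exp y * y - exp y + 1 ≤ exp z * z - exp z + 1 := by
  have h1 := Real.add_one_le_exp (y - z)
  have h2 : exp z * exp (y - z) = exp y := by rw [← Real.exp_add]; congr 1; ring
  have h3 := mul_le_mul_of_nonneg_left h1 (Real.exp_pos z).le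
  have h4 := Real.exp_le_exp.mpr hyz
  nlinarith [mul_nonneg hy (sub_nonneg.mpr h4)]

/-- `y ↦ (y e^y - e^y + 1) / (e^y - 1)` is monotone on the positive reals. -/
lemma mul_exp_sub_exp_add_one_div_le {y z : ℝ} (hy : 0 < y) (hyz : y ≤ z) :
    (exp y * y - exp y + 1) / (exp y - 1) ≤ (exp z * z - exp z + 1) / (exp z - 1) := by
  have hz : 0 < z := hy.trans_le hyz
  have hEy : 0 < exp y - 1 := sub_pos.mpr (Real.one_lt_exp_iff.mpr hy)
  have hEz : 0 < exp z - 1 := sub_pos.mpr (Real.one_lt_exp_iff.mpr hz)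
  have hconv := convexOn_exp.2 (Set.mem_univ 0) (Set.mem_univ (-z))
    (sub_nonneg.mpr ((div_le_one hz).mpr hyz)) (div_pos hy hz).le (by ring)
  have harg : (1 - y / z) • (0 : ℝ) + (y / z) • (-z) = -y := by
    simp only [smul_eq_mul]; field_simp; ring
  rw [harg] at hconv
  simp only [smul_eq_mul, Real.exp_zero] at hconv
  have h1 : z * exp (-y) ≤ z - y + y * exp (-z) := by
    calc z * exp (-y) ≤ z * ((1 - y / z) * 1 + y / z * exp (-z)) :=
          mul_le_mul_of_nonneg_left hconv hz.le
      _ = z - y + y * exp (-z) := by field_simp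
  have h2 : exp y * exp (-y) = 1 := by rw [← Real.exp_add]; simp
  have h3 : exp z * exp (-z) = 1 := by rw [← Real.exp_add]; simp
  have h4 : z * exp z ≤ (z - y) * (exp y * exp z) + y * exp y := by
    calc z * exp z = exp y * exp z * (z * exp (-y)) := by linear_combination (-(z * exp z)) * h2
      _ ≤ exp y * exp z * (z - y + y * exp (-z)) := by gcongr
      _ = (z - y) * (exp y * exp z) + y * exp y := by linear_combination (y * exp y) * h3
  rw [div_le_div_iff₀ hEy hEz]
  nlinarith

lemma two_rpow_sub_one_pos {x : ℝ} (hx : 0 < x) : 0 < (2 : ℝ) ^ x - 1 :=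
  sub_pos.mpr (Real.one_lt_rpow (by norm_num) hx)

lemma gfun_eq_sqrt {x : ℝ} (hx : 0 < x) :
    gfun x = √(x * ((exp (log 2 * x) * (log 2 * x) - exp (log 2 * x) + 1) / (exp (log 2 * x) - 1))
      * (exp (log 2 * x) * (log 2 * x) - exp (log 2 * x) + 1)) := by
  have hA := mul_exp_sub_exp_add_one_nonneg (log 2 * x)
  have hrw : (2 : ℝ) ^ x = exp (log 2 * x) := Real.rpow_def_of_pos (by norm_num) x
  have hE := two_rpow_sub_one_pos hx
  unfold gfun
  rw [hrw] at hE ⊢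
  set A := exp (log 2 * x) * (log 2 * x) - exp (log 2 * x) + 1 with hAdef
  have h1 : exp (log 2 * x) * x * log 2 - exp (log 2 * x) + 1 = A := by rw [hAdef]; ring
  rw [h1, show x * (A / (exp (log 2 * x) - 1)) * A = x / (exp (log 2 * x) - 1) * A ^ 2 by ring,
    Real.sqrt_mul (div_pos hx hE).le, Real.sqrt_sq hA]

lemma gfun_monotoneOn : MonotoneOn gfun (Set.Ioi 0) := by
  intro x hx y hy hxy
  have hx : 0 < x := hx
  have hy : 0 < y := hy
  have hl : 0 < log 2 := Real.log_pos (by norm_num)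
  have hlx : 0 < log 2 * x := by positivity
  have hle : log 2 * x ≤ log 2 * y := by gcongr
  have hA := mul_exp_sub_exp_add_one_nonneg (log 2 * x)
  have hA' := mul_exp_sub_exp_add_one_nonneg (log 2 * y)
  have hE' : 0 < exp (log 2 * y) - 1 := sub_pos.mpr (Real.one_lt_exp_iff.mpr (by positivity))
  rw [gfun_eq_sqrt hx, gfun_eq_sqrt hy]
  refine Real.sqrt_le_sqrt ?_
  refine mul_le_mul ?_ (mul_exp_sub_exp_add_one_le hlx.le hle) hA
    (mul_nonneg hy.le (div_nonneg hA' hE'.le))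
  refine mul_le_mul hxy (mul_exp_sub_exp_add_one_div_le hlx hle) ?_ hy.le
  exact div_nonneg hA (sub_pos.mpr (Real.one_lt_exp_iff.mpr hlx)).le

lemma hasDerivAt_sqrt_mul_two_rpow {R k : ℝ} (hR : 0 < R) (hk : 0 < k) :
    HasDerivAt (fun k : ℝ => √(k * ((2 : ℝ) ^ (R / k) - 1))) (-(gfun (R / k) / (2 * √R))) k := by
  have hx : 0 < R / k := div_pos hR hk
  have hE := two_rpow_sub_one_pos hx
  have h1 : HasDerivAt (fun k : ℝ => R / k) (-R / k ^ 2) k :=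
    ((hasDerivAt_const k R).div (hasDerivAt_id k) hk.ne').congr_deriv (by simp)
  have h2 := (hasDerivAt_id k).mul ((h1.const_rpow (a := 2) (by norm_num)).sub_const 1)
  have h3 := h2.sqrt (mul_pos hk hE).ne'
  refine h3.congr_deriv ?_
  simp only [Pi.mul_apply, id]
  unfold gfun
  set E := (2 : ℝ) ^ (R / k) - 1 with hEdef
  have hP : (2 : ℝ) ^ (R / k) = E + 1 := by rw [hEdef]; ring
  rw [hP, div_div, Real.sqrt_div hR.le]
  have hs : 0 < √(k * E) := Real.sqrt_pos.mpr (mul_pos hk hE)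
  have hsR : 0 < √R := Real.sqrt_pos.mpr hR
  field_simp
  ring

/-- The perfect-CSI power with the number of antennas optimised out, as a function of the number of
users, is minimised over `[1, ∞)` at `max (R / x') 1`, where `x'` solves the stationarity
equation. -/
lemma csi_power_min {α ρr ρd R x' k : ℝ} (hα : 0 < α) (hρr : 0 < ρr) (hR : 0 < R) (hx' : 0 < x')
    (hgx' : gfun x' = (1 + ρd / ρr) * √(R * ρr / α)) (hk : 1 ≤ k) :
    2 * √(α * ρr) * √(max (R / x') 1 * ((2 : ℝ) ^ (R / max (R / x') 1) - 1))
        + max (R / x') 1 * (ρr + ρd)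
      ≤ 2 * √(α * ρr) * √(k * ((2 : ℝ) ^ (R / k) - 1)) + k * (ρr + ρd) := by
  set h : ℝ → ℝ := fun k => 2 * √(α * ρr) * √(k * ((2 : ℝ) ^ (R / k) - 1)) + k * (ρr + ρd) with hh
  set c := √(α * ρr) / √R with hc
  have hc0 : 0 ≤ c := by positivity
  have hsR : 0 < √R := Real.sqrt_pos.mpr hR
  have hder : ∀ t : ℝ, 0 < t → HasDerivAt h (ρr + ρd - c * gfun (R / t)) t := by
    intro t ht
    have h1 := ((hasDerivAt_sqrt_mul_two_rpow hR ht).const_mul (2 * √(α * ρr))).add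
      ((hasDerivAt_id t).mul_const (ρr + ρd))
    refine h1.congr_deriv ?_
    rw [hc]
    field_simp
    ring
  have hcg : c * gfun x' = ρr + ρd := by
    have hmul : √(α * ρr) * √(R * ρr / α) = ρr * √R := by
      rw [← Real.sqrt_mul (by positivity),
        show α * ρr * (R * ρr / α) = ρr ^ 2 * R by field_simp,
        Real.sqrt_mul (by positivity), Real.sqrt_sq hρr.le]
    rw [hgx', hc]
    calc √(α * ρr) / √R * ((1 + ρd / ρr) * √(R * ρr / α))
        = (1 + ρd / ρr) * (√(α * ρr) * √(R * ρr / α)) / √R := by ring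
      _ = ρr + ρd := by rw [hmul]; field_simp
  have hcont : ∀ s : Set ℝ, (∀ t ∈ s, 0 < t) → ContinuousOn h s :=
    fun s hs t ht => (hder t (hs t ht)).continuousAt.continuousWithinAt
  have hm : 0 < max (R / x') 1 := by positivity
  change h (max (R / x') 1) ≤ h k
  rcases le_total (max (R / x') 1) k with hle | hle
  · have hmono : MonotoneOn h (Set.Ici (max (R / x') 1)) := by
      refine monotoneOn_of_deriv_nonneg (convex_Ici _)
        (hcont _ fun t ht => hm.trans_le ht)
        (fun t ht => ?_) (fun t ht => ?_)
      all_goals rw [interior_Ici] at ht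
      · exact (hder t (hm.trans ht)).differentiableAt.differentiableWithinAt
      · have ht0 : 0 < t := hm.trans ht
        rw [(hder t ht0).deriv, ← hcg]
        have : R / t ≤ x' := by
          have := (le_max_left (R / x') 1).trans (Set.mem_Ioi.mp ht).le
          rw [div_le_iff₀ hx'] at this
          rw [div_le_iff₀ ht0]; linarith
        exact sub_nonneg.mpr
          (mul_le_mul_of_nonneg_left (gfun_monotoneOn (div_pos hR ht0) hx' this) hc0)
    exact hmono Set.self_mem_Ici hle hle
  · rcases le_total (R / x') 1 with h1 | h1
    · rw [max_eq_right h1] at hle ⊢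
      rw [le_antisymm hle hk]
    · rw [max_eq_left h1] at hle ⊢
      have hanti : AntitoneOn h (Set.Icc 1 (R / x')) := by
        refine antitoneOn_of_deriv_nonpos (convex_Icc _ _)
          (hcont _ fun t ht => one_pos.trans_le ht.1)
          (fun t ht => ?_) (fun t ht => ?_)
        all_goals rw [interior_Icc] at ht
        · exact (hder t (one_pos.trans ht.1)).differentiableAt.differentiableWithinAt
        · have ht0 : 0 < t := one_pos.trans ht.1
          rw [(hder t ht0).deriv, ← hcg]
          have : x' ≤ R / t := by
            have := ht.2.le
            rw [le_div_iff₀ hx'] at this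
            rw [le_div_iff₀ ht0]; linarith
          exact sub_nonpos.mpr
            (mul_le_mul_of_nonneg_left (gfun_monotoneOn hx' (div_pos hR ht0) this) hc0)
      exact hanti ⟨hk, hle⟩ ⟨h1, le_rfl⟩ hle

lemma le_gammaU {M K τ R T : ℝ} (hR : 0 < R) (hK : 0 < K) (hKM : K < M) (hτ : 0 < τ)
    (hτT : τ < T) : ((2 : ℝ) ^ (R / K) - 1) / (M - K) ≤ gammaU M K τ R T := by
  have hT : 0 < T := hτ.trans hτT
  have hfrac : 0 < 1 - τ / T := sub_pos.mpr ((div_lt_one hT).mpr hτT)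
  have hKfrac : 0 < K * (1 - τ / T) := mul_pos hK hfrac
  have hE := two_rpow_sub_one_pos (div_pos hR hKfrac)
  have hEE : (2 : ℝ) ^ (R / K) - 1 ≤ (2 : ℝ) ^ (R / (K * (1 - τ / T))) - 1 := by
    have : R / K ≤ R / (K * (1 - τ / T)) := by
      refine div_le_div_of_nonneg_left hR.le hKfrac ?_
      nlinarith [mul_pos hK (div_pos hτ hT)]
    have := Real.rpow_le_rpow_of_exponent_le (x := 2) (by norm_num) this
    linarith
  have hMK : 0 < M - K := sub_pos.mpr hKM
  unfold gammaU
  set E := (2 : ℝ) ^ (R / (K * (1 - τ / T))) - 1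
  set u := (K + τ) * E / (2 * τ * (M - K)) with hu
  have hu0 : 0 ≤ u := by positivity
  have hsq : u ≤ √(u ^ 2 + E / (τ * (M - K))) :=
    Real.le_sqrt_of_sq_le (le_add_of_nonneg_right (by positivity))
  have h2u : E / (M - K) ≤ u + u := by
    have : u + u = E / (M - K) + K * E / (τ * (M - K)) := by rw [hu]; field_simp; ring
    rw [this]
    exact le_add_of_nonneg_right (by positivity)
  calc ((2 : ℝ) ^ (R / K) - 1) / (M - K) ≤ E / (M - K) := by gcongr
    _ ≤ u + u := h2u
    _ ≤ _ := by gcongr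

lemma gammaU_le {M K τ R T : ℝ} (hR : 0 < R) (hK : 0 < K) (hKM : K < M) (hKτ : K ≤ τ)
    (hτT : τ < T) :
    gammaU M K τ R T ≤ 2 * ((2 : ℝ) ^ (R / (K * (1 - τ / T))) - 1) / (M - K) + 1 / (2 * K) := by
  have hτ : 0 < τ := hK.trans_le hKτ
  have hT : 0 < T := hτ.trans hτT
  have hfrac : 0 < 1 - τ / T := sub_pos.mpr ((div_lt_one hT).mpr hτT)
  have hE := two_rpow_sub_one_pos (div_pos hR (mul_pos hK hfrac))
  have hMK : 0 < M - K := sub_pos.mpr hKM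
  unfold gammaU
  set E := (2 : ℝ) ^ (R / (K * (1 - τ / T))) - 1
  set u := (K + τ) * E / (2 * τ * (M - K)) with hu
  have hv : E / (τ * (M - K)) = 2 * u * (1 / (K + τ)) := by rw [hu]; field_simp
  have hsq : √(u ^ 2 + E / (τ * (M - K))) ≤ u + 1 / (K + τ) := by
    rw [hv]
    refine Real.sqrt_le_iff.mpr ⟨by positivity, ?_⟩
    nlinarith [sq_nonneg (1 / (K + τ))]
  have h2u : u + u ≤ 2 * E / (M - K) := by
    have : u + u = (K + τ) / τ * (E / (M - K)) := by rw [hu]; field_simp; ring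
    rw [this, mul_div_assoc]
    have : (K + τ) / τ ≤ 2 := by rw [div_le_iff₀ hτ]; linarith
    gcongr
  have hinv : 1 / (K + τ) ≤ 1 / (2 * K) :=
    one_div_le_one_div_of_le (by positivity) (by linarith)
  linarith

lemma two_mul_sqrt_le_div_add_mul {a b y : ℝ} (ha : 0 ≤ a) (hb : 0 ≤ b) (hy : 0 < y) :
    2 * √a * √b ≤ a / y + b * y := by
  have h1 : √a * √b = √(a / y) * √(b * y) := by
    rw [← Real.sqrt_mul ha, ← Real.sqrt_mul (by positivity)]
    congr 1; field_simp
  have h2 := two_mul_le_add_sq (√(a / y)) (√(b * y))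
  rw [Real.sq_sqrt (by positivity), Real.sq_sqrt (by positivity)] at h2
  linarith

/-- The zero-forcing power is bounded below by the perfect-CSI power with the number of antennas
optimised out. -/
lemma le_Ptot {M K τ R α ρr ρd ρs ρ0 T : ℝ} (hα : 0 < α) (hρr : 0 < ρr) (hρ0 : 0 < ρ0)
    (hR : 0 < R) (hK : 0 < K) (hKM : K < M) (hKτ : K ≤ τ) (hτT : τ < T) :
    2 * √(α * ρr) * √(K * ((2 : ℝ) ^ (R / K) - 1)) + K * (ρr + ρd) + ρs
      ≤ Ptot M K τ R α ρr ρd ρs ρ0 T := by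
  have hτ : 0 < τ := hK.trans_le hKτ
  have hT : 0 < T := hτ.trans hτT
  have hM : 0 < M := hK.trans hKM
  have hE := two_rpow_sub_one_pos (div_pos hR hK)
  have hγ := mul_le_mul_of_nonneg_left (le_gammaU hR hK hKM hτ hτT) (mul_pos hα hK).le
  have hAG := two_mul_sqrt_le_div_add_mul (a := α * K * ((2 : ℝ) ^ (R / K) - 1)) (b := ρr)
    (by positivity) hρr.le (sub_pos.mpr hKM)
  have hs : √(α * K * ((2 : ℝ) ^ (R / K) - 1)) * √ρr
      = √(α * ρr) * √(K * ((2 : ℝ) ^ (R / K) - 1)) := by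
    rw [← Real.sqrt_mul (by positivity), ← Real.sqrt_mul (by positivity)]
    congr 1; ring
  have h1 : 0 ≤ K * ((8 / 3) * K ^ 2 * ρ0 / T) := by positivity
  have h2 : 0 ≤ M * (2 * K * ρ0 + 4 * K ^ 2 * ρ0 / T) := by positivity
  rw [← mul_div_assoc] at hγ
  unfold Ptot
  nlinarith

/-- For `K` large compared with `k`, suitable `M` and `τ` bring the zero-forcing power below
`2 K / k` times the perfect-CSI power at `k` users. -/
lemma exists_Ptot_lt {k K R α ρr ρd ρs ρ0 T : ℝ} (hα : 0 < α) (hρr : 0 < ρr) (hρd : 0 < ρd)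
    (hρs : 0 < ρs) (hρ0 : 0 < ρ0) (hT : 0 < T) (hD1 : α / (2 * (ρs / ρr)) < ρr) (hR : 0 < R)
    (hk : 0 < k) (hkK : 4 / 3 * k < K) (hK : K < Kmax ρr ρd ρ0 T) :
    ∃ M τ : ℝ, K < M ∧ K ≤ τ ∧ τ < T ∧ Ptot M K τ R α ρr ρd ρs ρ0 T <
      2 * K / k * (2 * √(α * ρr) * √(k * ((2 : ℝ) ^ (R / k) - 1)) + k * (ρr + ρd) + ρs) := by
  obtain ⟨hKT, hKr, hKd⟩ : K < T / 4 ∧ K < ρr / (3 * ρ0) ∧ K < 3 * ρd / (2 * ρ0) := by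
    simpa only [Kmax, lt_min_iff] using hK
  rw [lt_div_iff₀ (by positivity)] at hKr hKd
  have hK0 : 0 < K := by linarith
  have hkK' : k < K := by linarith
  have hE := two_rpow_sub_one_pos (div_pos hR hk)
  set E := (2 : ℝ) ^ (R / k) - 1 with hEdef
  set w := √(α * K * E) / √ρr with hw
  have hsr : 0 < √ρr := Real.sqrt_pos.mpr hρr
  have hw0 : 0 < w := by positivity
  obtain ⟨τ, hτ⟩ : ∃ τ, τ = T * (1 - k / K) := ⟨_, rfl⟩
  have hfrac : K * (1 - τ / T) = k := by rw [hτ]; field_simp; ring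
  have hkK4 : k / K < 3 / 4 := by rw [div_lt_iff₀ hK0]; linarith
  have hKτ : K ≤ τ := by linarith [mul_lt_mul_of_pos_left hkK4 hT]
  have hτT : τ < T := by linarith [mul_pos hT (div_pos hk hK0)]
  refine ⟨K + w, τ, by linarith, hKτ, hτT, ?_⟩
  have hγ := gammaU_le hR hK0 (lt_add_of_pos_right K hw0) hKτ hτT
  rw [hfrac, ← hEdef, add_sub_cancel_left] at hγ
  have hγ' := mul_le_mul_of_nonneg_left hγ (mul_pos hα hK0).le
  have hsum : α * K * (2 * E / w + 1 / (2 * K)) = 2 * (√(α * K * E) * √ρr) + α / 2 := by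
    have hsq : √(α * K * E) ^ 2 = α * K * E := Real.sq_sqrt (by positivity)
    have hs0 : 0 < √(α * K * E) := by positivity
    rw [hw]
    field_simp
    linear_combination (-4 * √ρr) * hsq
  have hrw : ρr * w = √(α * K * E) * √ρr := by
    rw [hw]
    field_simp
    rw [Real.sq_sqrt hρr.le]
  have hδ : α / 2 < ρs := by
    rw [div_lt_iff₀ (by positivity)] at hD1
    have : ρr * (2 * (ρs / ρr)) = 2 * ρs := by field_simp
    linarith
  have hKsq : K ^ 2 * ρ0 / T ≤ K * ρ0 / 4 := by
    rw [div_le_iff₀ hT]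
    nlinarith [mul_pos hK0 hρ0]
  have hB : ρr + 2 * K * ρ0 + 4 * K ^ 2 * ρ0 / T < 2 * ρr := by
    have : 4 * K ^ 2 * ρ0 / T = 4 * (K ^ 2 * ρ0 / T) := by ring
    linarith
  have hD : ρd + 8 / 3 * K ^ 2 * ρ0 / T < 2 * ρd := by
    have : 8 / 3 * K ^ 2 * ρ0 / T = 8 / 3 * (K ^ 2 * ρ0 / T) := by ring
    linarith
  have hBw := mul_lt_mul_of_pos_left hB (add_pos hK0 hw0)
  have hDw := mul_lt_mul_of_pos_left hD hK0
  have hupper : Ptot (K + w) K τ R α ρr ρd ρs ρ0 T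
      < 4 * (√(α * K * E) * √ρr) + 2 * K * (ρr + ρd) + 2 * ρs := by
    rw [hsum] at hγ'
    unfold Ptot
    linarith
  refine hupper.trans_le ?_
  have hratio : 1 ≤ K / k := (one_le_div hk).mpr hkK'.le
  have hsqrt : √(α * K * E) * √ρr ≤ K / k * (√(α * ρr) * √(k * E)) := by
    rw [← Real.sqrt_mul (by positivity), ← Real.sqrt_mul (by positivity)]
    refine Real.sqrt_le_iff.mpr ⟨by positivity, ?_⟩
    rw [mul_pow, Real.sq_sqrt (by positivity)]
    calc α * K * E * ρr = K / k * (α * ρr * (k * E)) := by field_simp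
      _ ≤ (K / k) ^ 2 * (α * ρr * (k * E)) := by
        gcongr
        exact le_self_pow₀ hratio two_ne_zero
  have hKk : 2 * K / k * (k * (ρr + ρd)) = 2 * K * (ρr + ρd) := by field_simp
  calc 4 * (√(α * K * E) * √ρr) + 2 * K * (ρr + ρd) + 2 * ρs
      ≤ 4 * (K / k * (√(α * ρr) * √(k * E))) + 2 * K * (ρr + ρd) + 2 * (K / k * ρs) := by
        gcongr
        exact le_mul_of_one_le_left hρs.le hratio
    _ = 2 * K / k * (2 * √(α * ρr) * √(k * E) + k * (ρr + ρd) + ρs) := by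
        rw [← hKk]; ring

/-- bound on the EE loss due to a suboptimal (larger) fixed number of
users K (Theorem 7). -/
theorem stmt_19 (α ρr ρd ρs ρ0 T R x' K' : ℝ)
    (hα : 1 < α) (hρr : 0 < ρr) (hρd : 0 < ρd) (hρs : 0 < ρs) (hρ0 : 0 < ρ0) (hT : 1 < T)
    (hcond : 10 < min (T / 4)
      (min (1 / (3 * (ρ0 / ρr))) (3 * (ρd / ρr) / (2 * (ρ0 / ρr)))))
    (hD1 : ρr > α / (2 * (ρs / ρr)))
    (hR : 0 < R)
    (hx' : 0 < x') (hgx' : gfun x' = (1 + ρd / ρr) * Real.sqrt (R * ρr / α))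
    (hK' : K' = max (min (R / x') (Kmax ρr ρd ρ0 T)) 1)
    (hK'small : K' < (3/4) * Kmax ρr ρd ρ0 T) :
    ∀ K : ℝ, (4/3) * K' < K → K < Kmax ρr ρd ρ0 T →
      1 ≤ zetaZfPrime R α ρr ρd ρs ρ0 T / zetaZfFixedK K R α ρr ρd ρs ρ0 T ∧
        zetaZfPrime R α ρr ρd ρs ρ0 T / zetaZfFixedK K R α ρr ρd ρs ρ0 T <
          2 * K / K' := by
  intro K hK'K hKmax
  have hα0 : 0 < α := one_pos.trans hα
  have hK'1 : 1 ≤ K' := hK' ▸ le_max_right _ _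
  have hK'0 : 0 < K' := one_pos.trans_le hK'1
  have hK1 : 1 ≤ K := by linarith
  have hK'max : K' = max (R / x') 1 := by
    rcases le_total (R / x') (Kmax ρr ρd ρ0 T) with h | h
    · rwa [min_eq_left h] at hK'
    · rw [min_eq_right h] at hK'
      have := hK' ▸ le_max_left (Kmax ρr ρd ρ0 T) 1
      linarith
  set L := 2 * √(α * ρr) * √(K' * ((2 : ℝ) ^ (R / K') - 1)) + K' * (ρr + ρd) + ρs with hL
  have hL0 : 0 < L := by positivity
  set S := {p : ℝ | ∃ M K τ : ℝ, 1 ≤ K ∧ K ≤ Kmax ρr ρd ρ0 T ∧ K ≤ τ ∧ τ < T ∧ K < M ∧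
    p = Ptot M K τ R α ρr ρd ρs ρ0 T} with hS
  set S' := {p : ℝ | ∃ M τ : ℝ, K < M ∧ K ≤ τ ∧ τ < T ∧
    p = Ptot M K τ R α ρr ρd ρs ρ0 T} with hS'
  have hLS : ∀ p ∈ S, L ≤ p := by
    rintro p ⟨M, k, τ, hk1, -, hkτ, hτT, hkM, rfl⟩
    have h1 := csi_power_min hα0 hρr hR hx' hgx' hk1
    rw [← hK'max] at h1
    have h2 := le_Ptot (ρd := ρd) (ρs := ρs) hα0 hρr hρ0 hR (one_pos.trans_le hk1) hkM hkτ hτT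
    linarith
  have hsub : S' ⊆ S := by
    rintro p ⟨M, τ, hKM, hKτ, hτT, rfl⟩
    exact ⟨M, K, τ, hK1, hKmax.le, hKτ, hτT, hKM, rfl⟩
  obtain ⟨M, τ, hKM, hKτ, hτT, hlt⟩ :=
    exists_Ptot_lt hα0 hρr hρd hρs hρ0 (one_pos.trans hT) hD1 hR hK'0 hK'K hKmax
  have hmem : Ptot M K τ R α ρr ρd ρs ρ0 T ∈ S' := ⟨M, τ, hKM, hKτ, hτT, rfl⟩
  have hLinf : L ≤ sInf S := le_csInf ⟨_, hsub hmem⟩ hLS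
  have hinf : sInf S ≤ sInf S' := csInf_le_csInf ⟨L, hLS⟩ ⟨_, hmem⟩ hsub
  have hinf0 : 0 < sInf S := hL0.trans_le hLinf
  have hinf'0 : 0 < sInf S' := hinf0.trans_le hinf
  have hratio : zetaZfPrime R α ρr ρd ρs ρ0 T / zetaZfFixedK K R α ρr ρd ρs ρ0 T
      = sInf S' / sInf S := by
    change R / sInf S / (R / sInf S') = _
    field_simp
  rw [hratio]
  refine ⟨(one_le_div hinf0).mpr hinf, (div_lt_iff₀ hinf0).mpr ?_⟩
  calc sInf S' ≤ Ptot M K τ R α ρr ρd ρs ρ0 T := csInf_le ⟨L, fun p hp => hLS p (hsub hp)⟩ hmem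
    _ < 2 * K / K' * L := hlt
    _ ≤ 2 * K / K' * sInf S := by gcongr
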